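/- Let γ ∈ ℝ^C be a nonzero vector and let ρ be a C×C real matrix with |ρ_{ij}| ≤ 1 for all i, j. Define the matrix Σ by Σ_{ij} = γ_i·γ_j·ρ_{ij}/‖γ‖₂². Fix an index c with γ_c ≠ 0 and suppose that ∑_{j=1}^{C} γ_j²·ρ_{cj} < ‖γ‖₂². Then the c-th component of the vector (1/2)·(3·I − Σ)·γ has absolute value strictly greater than |γ_c|. -/

import Mathlib

open Matrix

/-- The first Newton iterate `(1/2)(3I - Σ)γ` applied to `γ`, where
`Σ = (γγᵀ/‖γ‖₂²) ⊙ ρ` with `ρ` a correlation matrix, strictly increases the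
magnitude of the `c`-th component, provided `∑_j γ_j² ρ_{cj} < ‖γ‖₂²`. -/
theorem newton_iterate_increases_gamma {C : ℕ} (γ : Fin C → ℝ) (hγ : γ ≠ 0)
    (ρ : Matrix (Fin C) (Fin C) ℝ) (hρ : ∀ i j, |ρ i j| ≤ 1)
    (S : Matrix (Fin C) (Fin C) ℝ)
    (hS : ∀ i j, S i j = γ i * γ j * ρ i j / (∑ k, γ k ^ 2))
    (c : Fin C) (hc : γ c ≠ 0)
    (hsum : ∑ j, γ j ^ 2 * ρ c j < ∑ k, γ k ^ 2) :
    |γ c| < |(((1 / 2 : ℝ) • ((3 : ℝ) • (1 : Matrix (Fin C) (Fin C) ℝ) - S)) *ᵥ γ) c| := by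
  have hN : 0 < ∑ k, γ k ^ 2 :=
    Finset.sum_pos' (fun k _ => sq_nonneg (γ k)) ⟨c, Finset.mem_univ c, by positivity⟩
  have hSγ : (S *ᵥ γ) c = γ c * ((∑ j, γ j ^ 2 * ρ c j) / ∑ k, γ k ^ 2) := by
    rw [mulVec, dotProduct, Finset.sum_div, Finset.mul_sum]
    refine Finset.sum_congr rfl fun j _ => ?_
    rw [hS]
    ring
  have hfactor : (((1 / 2 : ℝ) • ((3 : ℝ) • (1 : Matrix (Fin C) (Fin C) ℝ) - S)) *ᵥ γ) c
      = γ c * ((3 - (∑ j, γ j ^ 2 * ρ c j) / ∑ k, γ k ^ 2) / 2) := by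
    rw [smul_mulVec, sub_mulVec, smul_mulVec, one_mulVec, Pi.smul_apply, Pi.sub_apply,
      Pi.smul_apply, hSγ, smul_eq_mul, smul_eq_mul]
    ring
  have hratio : (∑ j, γ j ^ 2 * ρ c j) / ∑ k, γ k ^ 2 < 1 := (div_lt_one hN).mpr hsum
  rw [hfactor, abs_mul]
  refine lt_mul_of_one_lt_right (abs_pos.mpr hc) (lt_of_lt_of_le ?_ (le_abs_self _))
  linarith
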